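/- arXiv:1003.2573 — 10 statements merged into one kernel-verified Lean document; each statement's English description precedes it below -/
import Mathlib

section
/- Let (V, η) be a real vector space with a nondegenerate symmetric ℝ-bilinear form η, and let I₁, I₂, I₃ ∈ End_ℝ(V) satisfy I₁² = I₂² = I₃² = −id, I₃ = I₁I₂ = −I₂I₁, and η(I_α X, Y) = −η(X, I_α Y) for all X, Y ∈ V and α = 1,2,3. Let R : V × V → End_ℝ(V) be an ℝ-bilinear alternating map satisfying the first Bianchi identity, such that every R(X,Y) is η-skew-adjoint and commutes with I₁, I₂ and I₃. Then R(I_α X, Y) = −R(X, I_α Y) for all X, Y ∈ V and α = 1,2,3. -/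
theorem curvature_pair_symm {V : Type*} [AddCommGroup V] [Module ℝ V]
    (η : V →ₗ[ℝ] V →ₗ[ℝ] ℝ) (hsymm : ∀ u v : V, η u v = η v u)
    (R : V →ₗ[ℝ] V →ₗ[ℝ] Module.End ℝ V)
    (hAlt : ∀ u v : V, R u v = - R v u)
    (hBianchi : ∀ u v w : V, R u v w + R v w u + R w u v = 0)
    (hSkew : ∀ u v x y : V, η (R u v x) y + η x (R u v y) = 0) (x y z w : V) :
    η (R x y z) w = η (R z w x) y := by
  have alt (a b c d : V) : η (R a b c) d = - η (R b a c) d := by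
    rw [hAlt a b]; simp
  have skew (a b c d : V) : η (R a b c) d = - η (R a b d) c := by
    rw [hsymm (R a b d) c]; linarith [hSkew a b c d]
  have bianchi (a b c d : V) : η (R a b c) d + η (R b c a) d + η (R c a b) d = 0 := by
    simpa using congrArg (fun v => η v d) (hBianchi a b c)
  linarith [bianchi x y z w, bianchi y z w x, bianchi z w x y, bianchi w x y z,
    skew x y z w, skew y z x w, skew z x y w, alt z x y w, skew z x w y, alt z x w y,
    skew z w x y, alt w y z x, skew w y z x, alt w y x z, alt w x y z, skew w x y z,
    alt w x z y, alt x z w y, alt y w x z]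

theorem curvature_apply_left_of_skew_of_commute {V : Type*} [AddCommGroup V] [Module ℝ V]
    (η : V →ₗ[ℝ] V →ₗ[ℝ] ℝ) (hsymm : ∀ u v : V, η u v = η v u)
    (hnondeg : ∀ v : V, (∀ w : V, η v w = 0) → v = 0)
    (R : V →ₗ[ℝ] V →ₗ[ℝ] Module.End ℝ V)
    (hAlt : ∀ u v : V, R u v = - R v u)
    (hBianchi : ∀ u v w : V, R u v w + R v w u + R w u v = 0)
    (hSkew : ∀ u v x y : V, η (R u v x) y + η x (R u v y) = 0)
    (J : Module.End ℝ V) (hJ : ∀ X Y : V, η (J X) Y = - η X (J Y))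
    (hComm : ∀ u v : V, R u v * J = J * R u v) (X Y : V) :
    R (J X) Y = - R X (J Y) := by
  have pair := curvature_pair_symm η hsymm R hAlt hBianchi hSkew
  rw [← add_eq_zero_iff_eq_neg]
  refine LinearMap.ext fun Z => hnondeg _ fun W => ?_
  have commute : R Z W (J X) = J (R Z W X) := LinearMap.congr_fun (hComm Z W) X
  rw [LinearMap.add_apply, map_add, LinearMap.add_apply, pair (J X) Y, pair X (J Y), commute, hJ,
    neg_add_cancel]

/-- If `(V, η)` is a real vector space with a nondegenerate symmetric bilinear
form, `(I₁, I₂, I₃)` is a quaternionic structure with each `I_α` η-skew-adjoint, and `R` is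
an algebraic curvature tensor whose values are η-skew-adjoint and commute with `I₁, I₂, I₃`,
then `R(I_α X, Y) = − R(X, I_α Y)` for `α = 1, 2, 3`. -/
theorem curvature_anticommutes_with_quaternionic_structure
    (V : Type*) [AddCommGroup V] [Module ℝ V]
    (η : V →ₗ[ℝ] V →ₗ[ℝ] ℝ)
    (hsymm : ∀ u v : V, η u v = η v u)
    (hnondeg : ∀ v : V, (∀ w : V, η v w = 0) → v = 0)
    (I₁ I₂ I₃ : Module.End ℝ V)
    (hI1 : I₁ * I₁ = -1) (hI2 : I₂ * I₂ = -1) (hI3 : I₃ * I₃ = -1)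
    (hI12 : I₃ = I₁ * I₂) (hI21 : I₃ = -(I₂ * I₁))
    (hIskew1 : ∀ X Y : V, η (I₁ X) Y = - η X (I₁ Y))
    (hIskew2 : ∀ X Y : V, η (I₂ X) Y = - η X (I₂ Y))
    (hIskew3 : ∀ X Y : V, η (I₃ X) Y = - η X (I₃ Y))
    (R : V →ₗ[ℝ] V →ₗ[ℝ] Module.End ℝ V)
    (hAlt : ∀ u v : V, R u v = - R v u)
    (hBianchi : ∀ u v w : V, R u v w + R v w u + R w u v = 0)
    (hSkew : ∀ u v x y : V, η (R u v x) y + η x (R u v y) = 0)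
    (hComm1 : ∀ u v : V, R u v * I₁ = I₁ * R u v)
    (hComm2 : ∀ u v : V, R u v * I₂ = I₂ * R u v)
    (hComm3 : ∀ u v : V, R u v * I₃ = I₃ * R u v) :
    ∀ X Y : V, (R (I₁ X) Y = - R X (I₁ Y)) ∧ (R (I₂ X) Y = - R X (I₂ Y)) ∧
      (R (I₃ X) Y = - R X (I₃ Y)) := by
  intro X Y
  have key := curvature_apply_left_of_skew_of_commute η hsymm hnondeg R hAlt hBianchi hSkew
  exact ⟨key I₁ hIskew1 hComm1 X Y, key I₂ hIskew2 hComm2 X Y, key I₃ hIskew3 hComm3 X Y⟩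
end

section
/- Let 𝔤 be the set of all ℝ-linear endomorphisms of V = ℍ × ℍ that are η-skew-adjoint and commute with left multiplication by every quaternion, and let R be an algebraic curvature tensor of type 𝔤. Then for every quaternion c ∈ ℍ and all u, v ∈ V one has R(c·u, v) = R(u, (conj c)·v). -/
open Quaternion

noncomputable section

/-- `V = ℍ × ℍ`, the pseudo-quaternionic-Hermitian space `ℍ^{1,1}` in an isotropic basis. -/
abbrev V : Type := ℍ[ℝ] × ℍ[ℝ]

/-- The neutral-signature metric `η((x,y),(x',y')) = Re(x conj(y') + y conj(x'))`. -/
def η (u v : V) : ℝ := (u.1 * star v.2 + u.2 * star v.1).re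

/-- Left multiplication of a quaternion on `V`. -/
def qsmul (c : ℍ[ℝ]) (u : V) : V := (c * u.1, c * u.2)

/-- The Lie algebra `sp(1) ⊕ sp(1,1)`-type set: all endomorphisms of `V` that are
`η`-skew-adjoint and commute with left multiplication by every quaternion. -/
def 𝔤 : Set (Module.End ℝ V) :=
  {f | (∀ u v : V, η (f u) v + η u (f v) = 0) ∧
       (∀ (c : ℍ[ℝ]) (u : V), f (qsmul c u) = qsmul c (f u))}

lemma η_add_left (u v w : V) : η (u + v) w = η u w + η v w := by
  simp [η]
  ring

lemma η_neg_left (u w : V) : η (-u) w = -η u w := by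
  simp [η]
  ring

lemma η_zero_left (w : V) : η 0 w = 0 := by
  simp [η]

lemma η_comm (u v : V) : η u v = η v u := by
  simp [η]
  ring

lemma η_qsmul_left (c : ℍ[ℝ]) (u v : V) : η (qsmul c u) v = η u (qsmul (star c) v) := by
  simp [η, qsmul]
  ring

lemma eq_zero_of_forall_η_eq_zero {u : V} (h : ∀ v, η u v = 0) : u = 0 := by
  have h₁ : u.1 * star u.1 = 0 := by
    have := h (0, u.1)
    simp only [η, star_zero, mul_zero, add_zero, Quaternion.self_mul_star,
      Quaternion.re_coe] at this
    simp [Quaternion.self_mul_star, this]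
  have h₂ : u.2 * star u.2 = 0 := by
    have := h (u.2, 0)
    simp only [η, star_zero, mul_zero, zero_add, Quaternion.self_mul_star,
      Quaternion.re_coe] at this
    simp [Quaternion.self_mul_star, this]
  ext1
  · simpa using h₁
  · simpa using h₂

lemma eq_of_forall_η_eq {u v : V} (h : ∀ w, η u w = η v w) : u = v := by
  rw [← sub_eq_zero]
  refine eq_zero_of_forall_η_eq_zero fun w => ?_
  rw [sub_eq_add_neg, η_add_left, η_neg_left, h w, add_neg_cancel]

/-- The pair symmetry of an algebraic curvature tensor with `η`-skew-adjoint values. -/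
lemma η_curvature_pair_symm (R : V → V → Module.End ℝ V)
    (hAlt : ∀ u v : V, R u v = - R v u)
    (hSkew : ∀ u v w z : V, η (R u v w) z + η w (R u v z) = 0)
    (hBianchi : ∀ u v w : V, R u v w + R v w u + R w u v = 0) (u v w z : V) :
    η (R u v w) z = η (R w z u) v := by
  have alt (a b c d : V) : η (R a b c) d = -η (R b a c) d := by
    rw [hAlt a b, LinearMap.neg_apply, η_neg_left]
  have skew (a b c d : V) : η (R a b c) d = -η (R a b d) c := by
    rw [η_comm (R a b d) c]
    linarith [hSkew a b c d]
  have bianchi (a b c d : V) : η (R a b c) d + η (R b c a) d + η (R c a b) d = 0 := by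
    rw [← η_add_left, ← η_add_left, hBianchi, η_zero_left]
  linarith [bianchi u v w z, bianchi v w z u, bianchi w z u v, bianchi z u v w, skew v w u z,
    skew z u v w, skew w z v u, skew u w z v, skew v z u w, alt v z w u, skew u v z w,
    alt u w v z]

/-- Any algebraic curvature tensor of type `𝔤` satisfies
`R(c·u, v) = R(u, conj(c)·v)` for every quaternion `c`. -/
theorem curvature_quaternion_adjoint
    (R : V →ₗ[ℝ] V →ₗ[ℝ] Module.End ℝ V)
    (hAlt : ∀ u v : V, R u v = - R v u)
    (hVal : ∀ u v : V, R u v ∈ 𝔤)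
    (hBianchi : ∀ u v w : V, R u v w + R v w u + R w u v = 0) :
    ∀ (c : ℍ[ℝ]) (u v : V), R (qsmul c u) v = R u (qsmul (star c) v) := by
  intro c u v
  have symm := η_curvature_pair_symm (fun a b => R a b) hAlt
    (fun a b => (hVal a b).1) hBianchi
  refine LinearMap.ext fun w => eq_of_forall_η_eq fun z => ?_
  calc η (R (qsmul c u) v w) z = η (R w z (qsmul c u)) v := symm _ _ _ _
    _ = η (R w z u) (qsmul (star c) v) := by rw [(hVal w z).2, η_qsmul_left]
    _ = η (R u (qsmul (star c) v) w) z := (symm _ _ _ _).symm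

end
end

section
/- Let V be a real vector space with subspaces W and U such that V = W ⊕ U, and let I : V → V be an injective ℝ-linear map with W ∩ I(W) = {0}. If ξ : V → V is an ℝ-linear map satisfying ξ(W) ⊆ W, ξ(U) = {0}, and ξ ∘ I = I ∘ ξ, then ξ = 0. -/
/-- If `V = W ⊕ U`, `I : V → V` is injective linear with `W ∩ I(W) = 0`,
and `ξ : V → V` is linear with `ξ(W) ⊆ W`, `ξ(U) = 0` and `ξ ∘ I = I ∘ ξ`, then `ξ = 0`. -/
theorem xi_eq_zero_of_commutes
    (V : Type*) [AddCommGroup V] [Module ℝ V]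
    (W U : Submodule ℝ V)
    (hcompl : IsCompl W U)
    (I : V →ₗ[ℝ] V) (hI : Function.Injective I)
    (hWI : W ⊓ W.map I = ⊥)
    (ξ : V →ₗ[ℝ] V)
    (hξW : ∀ w ∈ W, ξ w ∈ W)
    (hξU : ∀ u ∈ U, ξ u = 0)
    (hcomm : ξ ∘ₗ I = I ∘ₗ ξ) :
    ξ = 0 := by
  have hrange : ∀ v, ξ v ∈ W := by
    intro v
    obtain ⟨w, hw, u, hu, rfl⟩ :=
      Submodule.mem_sup.1 (hcompl.sup_eq_top ▸ Submodule.mem_top : v ∈ W ⊔ U)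
    rw [map_add, hξU u hu, add_zero]
    exact hξW w hw
  ext v
  have hmem : I (ξ v) ∈ W ⊓ W.map I := by
    refine ⟨?_, Submodule.mem_map_of_mem (hrange v)⟩
    rw [← LinearMap.comp_apply, ← hcomm]
    exact hrange (I v)
  rw [hWI, Submodule.mem_bot] at hmem
  exact hI (by simpa using hmem)
end

section
/- Let V be a real vector space with a nondegenerate symmetric ℝ-bilinear form η, and suppose V = W ⊕ U where W and U are totally isotropic subspaces. Let 𝔤 be a set of η-skew-adjoint endomorphisms of V each of which maps W into W and U into U. Then every algebraic curvature tensor R of type 𝔤 satisfies R(x, y) = 0 for all x, y ∈ W. -/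
/-- If `V = W ⊕ U` with `W, U` totally isotropic for a nondegenerate symmetric
bilinear form `η`, and `𝔤` is a set of `η`-skew-adjoint endomorphisms preserving `W` and `U`,
then any algebraic curvature tensor of type `𝔤` vanishes on pairs of vectors from `W`. -/
theorem curvature_vanishes_on_isotropic_pairs
    (V : Type*) [AddCommGroup V] [Module ℝ V]
    (η : V →ₗ[ℝ] V →ₗ[ℝ] ℝ)
    (hsymm : ∀ u v : V, η u v = η v u)
    (hnondeg : ∀ v : V, (∀ w : V, η v w = 0) → v = 0)
    (W U : Submodule ℝ V)
    (hcompl : IsCompl W U)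
    (hWiso : ∀ w ∈ W, ∀ w' ∈ W, η w w' = 0)
    (hUiso : ∀ u ∈ U, ∀ u' ∈ U, η u u' = 0)
    (𝔤 : Set (Module.End ℝ V))
    (h𝔤 : ∀ f ∈ 𝔤, (∀ u v : V, η (f u) v + η u (f v) = 0) ∧
        (∀ w ∈ W, f w ∈ W) ∧ (∀ u ∈ U, f u ∈ U))
    (R : V →ₗ[ℝ] V →ₗ[ℝ] Module.End ℝ V)
    (hAlt : ∀ u v : V, R u v = - R v u)
    (hVal : ∀ u v : V, R u v ∈ 𝔤)
    (hBianchi : ∀ u v w : V, R u v w + R v w u + R w u v = 0) :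
    ∀ x ∈ W, ∀ y ∈ W, R x y = 0 := by
  intro x hx y hy
  obtain ⟨hskew, hW, hU⟩ := h𝔤 _ (hVal x y)
  have hsup : ∀ v : V, v ∈ W ⊔ U := fun v => by
    rw [hcompl.sup_eq_top]
    exact Submodule.mem_top
  have hRU : ∀ u ∈ U, R x y u = 0 := by
    intro u hu
    have hsum : R y u x + R u x y ∈ W :=
      W.add_mem ((h𝔤 _ (hVal y u)).2.1 x hx) ((h𝔤 _ (hVal u x)).2.1 y hy)
    have heq : R x y u = -(R y u x + R u x y) :=
      eq_neg_of_add_eq_zero_left (by rw [← add_assoc]; exact hBianchi x y u)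
    exact Submodule.disjoint_def.mp hcompl.disjoint _ (heq ▸ W.neg_mem hsum) (hU u hu)
  have hRW : ∀ w ∈ W, R x y w = 0 := by
    intro w hw
    refine hnondeg _ fun v => ?_
    obtain ⟨w', hw', u, hu, rfl⟩ := Submodule.mem_sup.mp (hsup v)
    have hpair := hskew w u
    rw [hRU u hu, map_zero, add_zero] at hpair
    rw [map_add, hWiso _ (hW w hw) w' hw', hpair, add_zero]
  ext v
  obtain ⟨w, hw, u, hu, rfl⟩ := Submodule.mem_sup.mp (hsup v)
  rw [map_add, hRW w hw, hRU u hu, add_zero, LinearMap.zero_apply]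
end

section
/- For all real numbers α, β with α² + β² = 1, there exist real numbers x₀, x₁ with x₀² + x₁² = 1 such that (x₀ + x₁ i) * (α j + β k) = j * (x₀ + x₁ i) in the quaternions. -/
open Quaternion

/-- The quaternion unit `i`. -/
def qi : ℍ[ℝ] := ⟨0, 1, 0, 0⟩

/-- The quaternion unit `j`. -/
def qj : ℍ[ℝ] := ⟨0, 0, 1, 0⟩

/-- The quaternion unit `k`. -/
def qk : ℍ[ℝ] := ⟨0, 0, 0, 1⟩

/-- for `α² + β² = 1` there are reals `x₀, x₁` with `x₀² + x₁² = 1` and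
`(x₀ + x₁ i)(α j + β k) = j (x₀ + x₁ i)` in the quaternions. -/
theorem exists_unit_complex_conjugating_to_j
    (α β : ℝ) (h : α ^ 2 + β ^ 2 = 1) :
    ∃ x₀ x₁ : ℝ, x₀ ^ 2 + x₁ ^ 2 = 1 ∧
      ((x₀ : ℍ[ℝ]) + x₁ • qi) * (α • qj + β • qk) = qj * ((x₀ : ℍ[ℝ]) + x₁ • qi) := by
  suffices H : ∃ x₀ x₁ : ℝ, x₀ ^ 2 + x₁ ^ 2 = 1 ∧
      x₀ * α - x₁ * β = x₀ ∧ x₀ * β + x₁ * α = -x₁ by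
    obtain ⟨x₀, x₁, hx, hj, hk⟩ := H
    refine ⟨x₀, x₁, hx, ?_⟩
    ext <;> simp <;> simp [qi, qj, qk] <;> linarith
  by_cases hα : α = -1
  · subst hα
    have hβ : β = 0 := by nlinarith
    exact ⟨0, 1, by simp [hβ]⟩
  · have hpos : 0 < 2 * (1 + α) := by
      have : -1 ≤ α := by nlinarith [sq_nonneg β]
      have := lt_of_le_of_ne this (Ne.symm hα)
      linarith
    have hs : √(2 * (1 + α)) ^ 2 = 2 * (1 + α) := Real.sq_sqrt hpos.le
    have hs0 : √(2 * (1 + α)) ≠ 0 := (Real.sqrt_pos.2 hpos).ne'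
    generalize √(2 * (1 + α)) = s at hs hs0
    refine ⟨(1 + α) / s, -β / s, ?_, ?_, ?_⟩
    · rw [div_pow, div_pow, hs, ← add_div, div_eq_one_iff_eq hpos.ne']
      linear_combination h
    · field_simp
      linear_combination h
    · field_simp
      ring
end

section
/- Let R be an algebraic curvature tensor of type 𝔤₁ = sp(1,1)_{ℍp}. Then for every x ∈ ℍ and every v ∈ V, there exists b ∈ ℍ with Re b = 0 such that R((x, 0), v) = T(0, b); that is, the 'diagonal part' of R(u, v) vanishes whenever u lies in the isotropic quaternionic line ℍ × {0}. -/
open Quaternion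

noncomputable section

/-- The endomorphism of `ℍ^{1,1}` with matrix `[[a, b], [0, -conj a]]` in the isotropic
basis `(p, q)`: `T(a,b)(x,y) = (x a + y b, − y conj(a))`. -/
def T (a b : ℍ[ℝ]) : Module.End ℝ V where
  toFun u := (u.1 * a + u.2 * b, -(u.2 * star a))
  map_add' u v := by
    simp only [Prod.fst_add, Prod.snd_add, add_mul, Prod.mk_add_mk, Prod.mk.injEq]
    constructor <;> abel
  map_smul' r u := by
    simp only [Prod.smul_fst, Prod.smul_snd, RingHom.id_apply, Prod.smul_mk,
      smul_mul_assoc, smul_add, smul_neg]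

/-- `R` is an algebraic curvature tensor of type `g`: a bilinear alternating map
`V × V → End_ℝ(V)` with values in `g` satisfying the first Bianchi identity. -/
def IsCurv (g : Set (Module.End ℝ V)) (R : V →ₗ[ℝ] V →ₗ[ℝ] Module.End ℝ V) : Prop :=
  (∀ u v : V, R u v = - R v u) ∧ (∀ u v : V, R u v ∈ g) ∧
  (∀ u v w : V, R u v w + R v w u + R w u v = 0)

/-- The Lie algebra `𝔤₁ = sp(1,1)_{ℍp}`. -/
def g1 : Set (Module.End ℝ V) := {f | ∃ a b : ℍ[ℝ], b.re = 0 ∧ f = T a b}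

/-- The second component of an element of `g1` acts by a right multiplication. -/
theorem snd_apply_of_mem_g1 {f : Module.End ℝ V} (hf : f ∈ g1) (w : V) :
    (f w).2 = w.2 * (f (0, 1)).2 := by
  obtain ⟨a, b, -, rfl⟩ := hf
  simp [T]

/-- The second component of the Bianchi identity for a curvature tensor of type `g1`. -/
theorem IsCurv.snd_bianchi {R : V →ₗ[ℝ] V →ₗ[ℝ] Module.End ℝ V} (hR : IsCurv g1 R)
    (u v w : V) :
    w.2 * (R u v (0, 1)).2 + u.2 * (R v w (0, 1)).2 + v.2 * (R w u (0, 1)).2 = 0 := by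
  rw [← snd_apply_of_mem_g1 (hR.2.1 u v), ← snd_apply_of_mem_g1 (hR.2.1 v w),
    ← snd_apply_of_mem_g1 (hR.2.1 w u)]
  exact congrArg Prod.snd (hR.2.2 u v w)

/-- A quaternion annihilated by all commutators vanishes. -/
theorem eq_zero_of_commutator_mul_eq_zero {c : ℍ[ℝ]}
    (h : ∀ y z : ℍ[ℝ], z * (y * c) = y * (z * c)) : c = 0 := by
  by_contra hc
  have hcomm : ∀ y z : ℍ[ℝ], z * y = y * z := fun y z =>
    mul_right_cancel₀ hc (by rw [mul_assoc, mul_assoc, h])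
  have hk : ∀ y z : ℍ[ℝ],
      z.re * y.imK + z.imI * y.imJ - z.imJ * y.imI + z.imK * y.re =
        y.re * z.imK + y.imI * z.imJ - y.imJ * z.imI + y.imK * z.re := fun y z => by
    rw [← Quaternion.imK_mul, ← Quaternion.imK_mul, hcomm]
  have hij := hk ⟨0, 0, 1, 0⟩ ⟨0, 1, 0, 0⟩
  norm_num at hij

/-- The diagonal part of `R((x,0), v)` vanishes. -/
theorem IsCurv.snd_apply_eq_zero {R : V →ₗ[ℝ] V →ₗ[ℝ] Module.End ℝ V} (hR : IsCurv g1 R)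
    (x : ℍ[ℝ]) (v : V) : (R (x, 0) v (0, 1)).2 = 0 := by
  have hp : ∀ y : ℍ[ℝ], (R (x, 0) (y, 0) (0, 1)).2 = 0 := fun y => by
    simpa using hR.snd_bianchi (x, 0) (y, 0) (0, 1)
  have hswap : ∀ y z : ℍ[ℝ],
      z * (R (x, 0) (0, y) (0, 1)).2 = y * (R (x, 0) (0, z) (0, 1)).2 := fun y z => by
    have h := hR.snd_bianchi (x, 0) (0, y) (0, z)
    rw [hR.1 (0, z) (x, 0)] at h
    simpa [add_neg_eq_zero] using h
  have hone : ∀ y : ℍ[ℝ],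
      (R (x, 0) (0, y) (0, 1)).2 = y * (R (x, 0) (0, 1) (0, 1)).2 := fun y => by
    simpa using hswap y 1
  have hc : (R (x, 0) (0, 1) (0, 1)).2 = 0 :=
    eq_zero_of_commutator_mul_eq_zero fun y z => by
      rw [← hone y, ← hone z, hswap]
  have hv : v = (v.1, 0) + (0, v.2) := by simp
  rw [hv, map_add, LinearMap.add_apply, Prod.snd_add, hp, hone, hc, mul_zero, add_zero]

/-- for a curvature tensor of type `sp(1,1)_{ℍp}`, the value `R((x,0), v)`
is strictly upper triangular: it equals `T(0,b)` for some imaginary quaternion `b`. -/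
theorem curvature_on_Hp_strictly_upper_triangular
    (R : V →ₗ[ℝ] V →ₗ[ℝ] Module.End ℝ V) (hR : IsCurv g1 R) :
    ∀ (x : ℍ[ℝ]) (v : V), ∃ b : ℍ[ℝ], b.re = 0 ∧ R (x, 0) v = T 0 b := by
  intro x v
  obtain ⟨a, b, hb, h⟩ := hR.2.1 (x, 0) v
  have ha : a = 0 := by
    have h0 := hR.snd_apply_eq_zero x v
    rw [h] at h0
    simpa [T] using h0
  exact ⟨b, hb, by rw [h, ha]⟩

end
end

section
/- Set e₀ = 1, e₁ = i, e₂ = j, e₃ = k in the quaternions ℍ. If A : Fin 4 → Fin 4 → ℍ satisfies e_t * A r s = e_r * A t s for all r, s, t ∈ Fin 4, then A r s = 0 for all r, s. -/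
open Quaternion

/-- The quaternionic units `e₀ = 1`, `e₁ = i`, `e₂ = j`, `e₃ = k`. -/
noncomputable def e : Fin 4 → ℍ[ℝ] := ![1, ⟨0, 1, 0, 0⟩, ⟨0, 0, 1, 0⟩, ⟨0, 0, 0, 1⟩]

theorem e_two_mul_e_one_ne : e 2 * e 1 ≠ e 1 * e 2 := by
  intro h
  have hk := congrArg QuaternionAlgebra.imK h
  rw [Quaternion.imK_mul, Quaternion.imK_mul] at hk
  have h1 : e 1 = ⟨0, 1, 0, 0⟩ := rfl
  have h2 : e 2 = ⟨0, 0, 1, 0⟩ := rfl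
  rw [h1, h2] at hk
  norm_num at hk

/-- if `e_t * A_{rs} = e_r * A_{ts}` for all `r, s, t`, then `A = 0`. -/
theorem coeffs_vanish_of_bianchi_relation
    (A : Fin 4 → Fin 4 → ℍ[ℝ])
    (h : ∀ r s t : Fin 4, e t * A r s = e r * A t s) :
    ∀ r s : Fin 4, A r s = 0 := by
  intro r s
  have hA (t : Fin 4) : A t s = e t * A 0 s := by
    simpa [e] using (h 0 s t).symm
  have h12 := h 1 s 2
  rw [hA 1, hA 2, ← mul_assoc, ← mul_assoc] at h12
  have h0 : A 0 s = 0 := (mul_eq_mul_right_iff.mp h12).resolve_left e_two_mul_e_one_ne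
  rw [hA r, h0, mul_zero]
end

section
/- The Lie algebra 𝔤₁ = sp(1,1)_{ℍp} = {T(a,b) | a ∈ ℍ, b ∈ ℍ, Re b = 0} is a Berger algebra: the endomorphisms R(u, v), for R an algebraic curvature tensor of type 𝔤₁ and u, v ∈ V, span 𝔤₁ over ℝ. -/
open Quaternion

noncomputable section

/-- The Lie algebra `𝔤₁ = sp(1,1)_{ℍp} = {T(a,b) | a ∈ ℍ, b ∈ Im ℍ}`. -/
def g : Set (Module.End ℝ V) := {f | ∃ a b : ℍ[ℝ], b.re = 0 ∧ f = T a b}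

/-- The map `c ↦ c_i a + c_j a k`: the `a`-part of the curvature tensor `curv a b`, as a function
of `conj(y) y'`. -/
def ψ (a c : ℍ[ℝ]) : ℍ[ℝ] :=
  ⟨c.imI * a.re - c.imJ * a.imK,
    c.imI * a.imI + c.imJ * a.imJ,
    c.imI * a.imJ - c.imJ * a.imI,
    c.imI * a.imK + c.imJ * a.re⟩

@[simp] lemma ψ_re (a c : ℍ[ℝ]) : (ψ a c).re = c.imI * a.re - c.imJ * a.imK := rfl

@[simp] lemma ψ_imI (a c : ℍ[ℝ]) : (ψ a c).imI = c.imI * a.imI + c.imJ * a.imJ := rfl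

@[simp] lemma ψ_imJ (a c : ℍ[ℝ]) : (ψ a c).imJ = c.imI * a.imJ - c.imJ * a.imI := rfl

@[simp] lemma ψ_imK (a c : ℍ[ℝ]) : (ψ a c).imK = c.imI * a.imK + c.imJ * a.re := rfl

/-- The map `c ↦ ψ a c + c (a_0 i - a_k j)`: the part of the curvature tensor `curv a b` that
depends on `conj(x) y'`. -/
def Φ (a c : ℍ[ℝ]) : ℍ[ℝ] :=
  ⟨0,
    c.re * a.re + c.imI * a.imI + c.imJ * a.imJ + c.imK * a.imK,
    c.imI * a.imJ - c.imJ * a.imI - c.re * a.imK + c.imK * a.re,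
    0⟩

@[simp] lemma Φ_re (a c : ℍ[ℝ]) : (Φ a c).re = 0 := rfl

@[simp] lemma Φ_imI (a c : ℍ[ℝ]) :
    (Φ a c).imI = c.re * a.re + c.imI * a.imI + c.imJ * a.imJ + c.imK * a.imK := rfl

@[simp] lemma Φ_imJ (a c : ℍ[ℝ]) :
    (Φ a c).imJ = c.imI * a.imJ - c.imJ * a.imI - c.re * a.imK + c.imK * a.re := rfl

@[simp] lemma Φ_imK (a c : ℍ[ℝ]) : (Φ a c).imK = 0 := rfl

/-- The symmetric traceless endomorphism of `Im ℍ` sending `i` to `Im b`, `j` to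
`b_j i - b_i j` and `k` to `b_k i`, extended by zero to `ℍ`. -/
def χ (b c : ℍ[ℝ]) : ℍ[ℝ] :=
  ⟨0,
    c.imI * b.imI + c.imJ * b.imJ + c.imK * b.imK,
    c.imI * b.imJ - c.imJ * b.imI,
    c.imI * b.imK⟩

@[simp] lemma χ_re (b c : ℍ[ℝ]) : (χ b c).re = 0 := rfl

@[simp] lemma χ_imI (b c : ℍ[ℝ]) :
    (χ b c).imI = c.imI * b.imI + c.imJ * b.imJ + c.imK * b.imK := rfl

@[simp] lemma χ_imJ (b c : ℍ[ℝ]) : (χ b c).imJ = c.imI * b.imJ - c.imJ * b.imI := rfl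

@[simp] lemma χ_imK (b c : ℍ[ℝ]) : (χ b c).imK = c.imI * b.imK := rfl

lemma ψ_add (a c d : ℍ[ℝ]) : ψ a (c + d) = ψ a c + ψ a d := by
  ext <;> simp <;> ring

lemma ψ_smul (a : ℍ[ℝ]) (r : ℝ) (c : ℍ[ℝ]) : ψ a (r • c) = r • ψ a c := by
  ext <;> simp <;> ring

lemma Φ_add (a c d : ℍ[ℝ]) : Φ a (c + d) = Φ a c + Φ a d := by
  ext <;> simp <;> ring

lemma Φ_smul (a : ℍ[ℝ]) (r : ℝ) (c : ℍ[ℝ]) : Φ a (r • c) = r • Φ a c := by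
  ext <;> simp <;> ring

lemma χ_add (b c d : ℍ[ℝ]) : χ b (c + d) = χ b c + χ b d := by
  ext <;> simp <;> ring

lemma χ_smul (b : ℍ[ℝ]) (r : ℝ) (c : ℍ[ℝ]) : χ b (r • c) = r • χ b c := by
  ext <;> simp <;> ring

lemma T_add (a b c d : ℍ[ℝ]) : T (a + c) (b + d) = T a b + T c d := by
  refine LinearMap.ext fun u => Prod.ext ?_ ?_ <;> simp [T, mul_add] <;> abel

lemma T_smul (r : ℝ) (a b : ℍ[ℝ]) : T (r • a) (r • b) = r • T a b := by
  refine LinearMap.ext fun u => Prod.ext ?_ ?_ <;> simp [T]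

/-- A family of algebraic curvature tensors of type `g`, with value `T a b` on `(q, i q)`
when `Re b = 0`. -/
def curv (a b : ℍ[ℝ]) : V →ₗ[ℝ] V →ₗ[ℝ] Module.End ℝ V :=
  LinearMap.mk₂ ℝ
    (fun u v => T (ψ a (star u.2 * v.2))
      (Φ a (star u.1 * v.2) - Φ a (star v.1 * u.2) + χ b (star u.2 * v.2)))
    (fun u u' v => by
      rw [← T_add]
      congr 1 <;> simp only [Prod.fst_add, Prod.snd_add, star_add, add_mul, mul_add,
        ψ_add, Φ_add, χ_add]
      abel)
    (fun r u v => by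
      rw [← T_smul]
      congr 1 <;> simp only [Prod.smul_fst, Prod.smul_snd, Quaternion.star_smul,
        smul_mul_assoc, mul_smul_comm, ψ_smul, Φ_smul, χ_smul, smul_add, smul_sub])
    (fun u v v' => by
      rw [← T_add]
      congr 1 <;> simp only [Prod.fst_add, Prod.snd_add, star_add, add_mul, mul_add,
        ψ_add, Φ_add, χ_add]
      abel)
    (fun r u v => by
      rw [← T_smul]
      congr 1 <;> simp only [Prod.smul_fst, Prod.smul_snd, Quaternion.star_smul,
        smul_mul_assoc, mul_smul_comm, ψ_smul, Φ_smul, χ_smul, smul_add, smul_sub])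

lemma curv_apply (a b : ℍ[ℝ]) (u v : V) :
    curv a b u v = T (ψ a (star u.2 * v.2))
      (Φ a (star u.1 * v.2) - Φ a (star v.1 * u.2) + χ b (star u.2 * v.2)) := rfl

lemma curv_bianchi (a b : ℍ[ℝ]) (u v w : V) :
    curv a b u v w + curv a b v w u + curv a b w u v = 0 := by
  simp only [curv_apply]
  refine Prod.ext ?_ ?_ <;> ext <;> simp [T] <;> ring

lemma curv_antisymm (a b : ℍ[ℝ]) (u v : V) : curv a b u v = -curv a b v u := by
  rw [curv_apply, curv_apply, ← neg_one_smul ℝ, ← T_smul]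
  congr 1 <;> ext <;> simp <;> ring

lemma isCurv_curv (a b : ℍ[ℝ]) : IsCurv g (curv a b) :=
  ⟨curv_antisymm a b, fun _ _ => ⟨_, _, by simp, curv_apply a b _ _⟩,
    curv_bianchi a b⟩

lemma curv_q (a b c : ℍ[ℝ]) : curv a b (0, 1) (0, c) = T (ψ a c) (χ b c) := by
  have h0 : Φ a 0 = 0 := by ext <;> simp
  simp [curv_apply, h0]

/-- The quaternion unit `i`. -/
def unitI : ℍ[ℝ] := ⟨0, 1, 0, 0⟩

@[simp] lemma unitI_imI : unitI.imI = 1 := rfl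

@[simp] lemma unitI_imJ : unitI.imJ = 0 := rfl

@[simp] lemma unitI_imK : unitI.imK = 0 := rfl

lemma curv_q_iq (a b : ℍ[ℝ]) (hb : b.re = 0) : curv a b (0, 1) (0, unitI) = T a b := by
  rw [curv_q]
  congr 1 <;> ext <;> simp [hb]

/-- this Lie algebra is a Berger algebra: the endomorphisms `R u v`, for
`R` an algebraic curvature tensor of type the algebra and `u, v ∈ V`, span it over ℝ. -/
theorem g1_is_berger_algebra :
    Submodule.span ℝ {f : Module.End ℝ V |
        ∃ R : V →ₗ[ℝ] V →ₗ[ℝ] Module.End ℝ V, IsCurv g R ∧ ∃ u v : V, f = R u v}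
      = Submodule.span ℝ g := by
  congr 1
  ext f
  constructor
  · rintro ⟨R, hR, u, v, rfl⟩
    exact hR.2.1 u v
  · rintro ⟨a, b, hb, rfl⟩
    exact ⟨curv a b, isCurv_curv a b, (0, 1), (0, unitI), (curv_q_iq a b hb).symm⟩

end
end

section
/- For the Lie algebra 𝔥 = {T(a,0) | a ∈ ℍ} ⊂ End_ℝ(V), every algebraic curvature tensor of type 𝔥 is identically zero; in particular 𝔥 is not a Berger algebra. -/
open Quaternion

noncomputable section

/-- The Lie algebra `𝔥 = {T(a,0) | a ∈ ℍ}`. -/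
def h : Set (Module.End ℝ V) := {f | ∃ a : ℍ[ℝ], f = T a 0}

@[simp] lemma T_apply (a b x y : ℍ[ℝ]) : T a b (x, y) = (x * a + y * b, -(y * star a)) := rfl

lemma T_zero_zero : T 0 0 = 0 := by
  ext u <;> simp [T]

namespace IsCurv

variable {R : V →ₗ[ℝ] V →ₗ[ℝ] Module.End ℝ V}

/-- A curvature tensor of type `𝔥` is `T(ρ,0)` for an `ℍ`-valued form `ρ`, and the Bianchi
identity splits into one identity for each isotropic coordinate. -/
lemma exists_form (hR : IsCurv h R) :
    ∃ ρ : V → V → ℍ[ℝ], (∀ u v, R u v = T (ρ u v) 0) ∧ (∀ u v, ρ u v = -ρ v u) ∧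
      (∀ u v w, w.1 * ρ u v + u.1 * ρ v w + v.1 * ρ w u = 0) ∧
      (∀ u v w, w.2 * star (ρ u v) + u.2 * star (ρ v w) + v.2 * star (ρ w u) = 0) := by
  obtain ⟨hskew, hmem, hbianchi⟩ := hR
  choose ρ hρ using hmem
  refine ⟨ρ, hρ, fun u v => ?_, fun u v w => ?_, fun u v w => ?_⟩
  · have := congrArg (fun f : Module.End ℝ V => (f (1, 0)).1) (hskew u v)
    simpa [hρ] using this
  · simpa [hρ, T] using congrArg Prod.fst (hbianchi u v w)
  · have := congrArg Prod.snd (hbianchi u v w)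
    simp only [hρ, T, LinearMap.coe_mk, AddHom.coe_mk, Prod.snd_add, Prod.snd_zero] at this
    rw [← neg_eq_zero, ← this]
    abel

/-- The mixed part is `ρ((x,0),(0,y)) = x β(y)`, and left multiplication by `x` and `x'` would
have to commute on `β(y)`, which forces `β(y) = 0`. -/
lemma eq_zero (hR : IsCurv h R) : R = 0 := by
  obtain ⟨ρ, hρ, hskew, hfst, hsnd⟩ := hR.exists_form
  have hRzero {u v : V} (huv : ρ u v = 0) : R u v = 0 := by rw [hρ, huv, T_zero_zero]
  have hpp (x x' : ℍ[ℝ]) : ρ (x, 0) (x', 0) = 0 := by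
    simpa using hsnd (x, 0) (x', 0) (0, 1)
  have hqq (y y' : ℍ[ℝ]) : ρ (0, y) (0, y') = 0 := by
    simpa using hfst (0, y) (0, y') (1, 0)
  have hcomm (x x' y : ℍ[ℝ]) : x * ρ (x', 0) (0, y) = x' * ρ (x, 0) (0, y) := by
    have := hfst (x, 0) (x', 0) (0, y)
    rw [hskew (0, y) (x, 0)] at this
    simpa [add_neg_eq_zero] using this
  have hpq (x y : ℍ[ℝ]) : ρ (x, 0) (0, y) = 0 := by
    have hlin (z : ℍ[ℝ]) : ρ (z, 0) (0, y) = z * ρ (1, 0) (0, y) := by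
      simpa using hcomm 1 z y
    have hβ : ρ (1, 0) (0, y) = 0 := by
      let i : ℍ[ℝ] := ⟨0, 1, 0, 0⟩
      let j : ℍ[ℝ] := ⟨0, 0, 1, 0⟩
      have hij : i * j - j * i ≠ 0 := fun h0 => by
        have := congrArg (fun q : ℍ[ℝ] => q.imK) h0
        rw [Quaternion.imK_sub, Quaternion.imK_mul, Quaternion.imK_mul] at this
        norm_num [i, j] at this
      have := hcomm i j y
      rw [hlin i, hlin j, ← mul_assoc, ← mul_assoc, ← sub_eq_zero, ← sub_mul] at this
      exact (mul_eq_zero.mp this).resolve_left hij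
    rw [hlin, hβ, mul_zero]
  have hqp (x y : ℍ[ℝ]) : ρ (0, y) (x, 0) = 0 := by rw [hskew, hpq, neg_zero]
  refine LinearMap.ext fun u => LinearMap.ext fun v => ?_
  obtain ⟨x, y⟩ := u
  obtain ⟨x', y'⟩ := v
  have hsplit (x y : ℍ[ℝ]) : ((x, y) : V) = (x, 0) + (0, y) := by simp
  rw [hsplit x y, hsplit x' y']
  simp only [map_add, LinearMap.add_apply, hRzero (hpp _ _), hRzero (hpq _ _),
    hRzero (hqp _ _), hRzero (hqq _ _), LinearMap.zero_apply, add_zero]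

end IsCurv

/-- every algebraic curvature tensor of type `𝔥 = {T(a,0) | a ∈ ℍ}` is
identically zero; in particular `𝔥` is not a Berger algebra. -/
theorem h_curvature_zero_and_not_berger :
    (∀ R : V →ₗ[ℝ] V →ₗ[ℝ] Module.End ℝ V, IsCurv h R → R = 0) ∧
    Submodule.span ℝ {f : Module.End ℝ V |
        ∃ R : V →ₗ[ℝ] V →ₗ[ℝ] Module.End ℝ V, IsCurv h R ∧ ∃ u v : V, f = R u v}
      ≠ Submodule.span ℝ h := by
  refine ⟨fun R hR => hR.eq_zero, fun hspan => ?_⟩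
  have hmem : T 1 0 ∈ Submodule.span ℝ h := Submodule.subset_span ⟨1, rfl⟩
  rw [← hspan] at hmem
  have hbot : T 1 0 ∈ (⊥ : Submodule ℝ (Module.End ℝ V)) := by
    refine Submodule.span_le.mpr ?_ hmem
    rintro _ ⟨R, hR, u, v, rfl⟩
    simp [hR.eq_zero]
  have := congrArg (fun f : Module.End ℝ V => (f (1, 0)).1) ((Submodule.mem_bot ℝ).mp hbot)
  simp at this

end
end

section
/- Let c₁, c₂ ∈ ℍ with Re c₁ = 0, Re c₂ = 0, c₁ * i = i * c₁, and c₂ * j = j * c₂. Set c₃ = c₂ * i − c₁ * j. If c₂ * i − i * c₂ = −2 c₃ and c₁ * j − j * c₁ = 2 c₃, then c₁ = 0 and c₂ = 0. -/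
open Quaternion

@[simp] theorem qi_re : qi.re = 0 := rfl
@[simp] theorem qi_imI : qi.imI = 1 := rfl
@[simp] theorem qi_imJ : qi.imJ = 0 := rfl
@[simp] theorem qi_imK : qi.imK = 0 := rfl

@[simp] theorem qj_re : qj.re = 0 := rfl
@[simp] theorem qj_imI : qj.imI = 0 := rfl
@[simp] theorem qj_imJ : qj.imJ = 1 := rfl
@[simp] theorem qj_imK : qj.imK = 0 := rfl

/-- if `c₁, c₂` are imaginary quaternions with `c₁ i = i c₁`, `c₂ j = j c₂`,
and, with `c₃ = c₂ i − c₁ j`, also `c₂ i − i c₂ = −2 c₃` and `c₁ j − j c₁ = 2 c₃`,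
then `c₁ = c₂ = 0`. -/
theorem coeffs_vanish_symmetric_case
    (c₁ c₂ : ℍ[ℝ]) (h₁ : c₁.re = 0) (h₂ : c₂.re = 0)
    (hcomm₁ : c₁ * qi = qi * c₁) (hcomm₂ : c₂ * qj = qj * c₂)
    (h3 : c₂ * qi - qi * c₂ = -(2 * (c₂ * qi - c₁ * qj)))
    (h4 : c₁ * qj - qj * c₁ = 2 * (c₂ * qi - c₁ * qj)) :
    c₁ = 0 ∧ c₂ = 0 := by
  simp only [two_mul, Quaternion.ext_iff, Quaternion.imI_mul, Quaternion.imJ_mul,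
    Quaternion.imK_mul, Quaternion.imK_sub, Quaternion.imK_neg, Quaternion.imK_add,
    qi_re, qi_imI, qi_imJ, qi_imK, qj_re, qj_imI, qj_imJ, qj_imK] at hcomm₁ hcomm₂ h3 h4
  obtain ⟨-, -, hJ₁, hK₁⟩ := hcomm₁
  obtain ⟨-, hI₂, -, hK₂⟩ := hcomm₂
  obtain ⟨-, -, -, h3⟩ := h3
  obtain ⟨-, -, -, h4⟩ := h4
  constructor <;> ext <;>
    simp only [Quaternion.re_zero, Quaternion.imI_zero, Quaternion.imJ_zero,
      Quaternion.imK_zero] <;> linarith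
end
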